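/- arXiv:2603.09382 — 3 statements merged into one kernel-verified Lean document; each statement's English description precedes it below -/
import Mathlib

section
/- Let T > 0, let u, y : ℝ → ℝ with y differentiable on [0,T] with derivative y', and suppose u is differentiable on [0,T] with derivative u'. Assume there exists t₀ ∈ [0,T] with y(t₀) = 0, and let λ, λ∂, U ≥ 0 satisfy ‖y‖_T ≤ λ · ‖u‖_T, ‖y'‖_T ≤ λ∂ · ‖u'‖_T, and ‖u‖_T · ‖u'‖_T ≤ U. Then for every t ∈ [0,T] one has |y(t)| ≤ √(2 · λ · λ∂ · U). -/
open MeasureTheory Real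

/-- The `L²` norm of `u` on `[0, T]`. -/
noncomputable def normT (T : ℝ) (u : ℝ → ℝ) : ℝ :=
  Real.sqrt (∫ t in (0:ℝ)..T, (u t) ^ 2)

/-- The amplitude bound (13)–(14): combining the gains `‖y‖_T ≤ λ‖u‖_T` and
`‖y'‖_T ≤ λ∂‖u'‖_T` with the harmonic-energy constraint `‖u‖_T‖u'‖_T ≤ U`
gives a sup-norm bound on the output `y`. -/
theorem stmt_2 (T : ℝ) (hT : 0 < T) (u u' y y' : ℝ → ℝ)
    (hyderiv : ∀ t ∈ Set.Icc (0:ℝ) T, HasDerivWithinAt y (y' t) (Set.Icc (0:ℝ) T) t)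
    (huderiv : ∀ t ∈ Set.Icc (0:ℝ) T, HasDerivWithinAt u (u' t) (Set.Icc (0:ℝ) T) t)
    (hy'L2 : IntervalIntegrable (fun t => (y' t) ^ 2) volume 0 T)
    (hu'L2 : IntervalIntegrable (fun t => (u' t) ^ 2) volume 0 T)
    (t₀ : ℝ) (ht₀ : t₀ ∈ Set.Icc (0:ℝ) T) (hy0 : y t₀ = 0)
    (lam lamd U : ℝ) (hlam : 0 ≤ lam) (hlamd : 0 ≤ lamd) (hU : 0 ≤ U)
    (h1 : normT T y ≤ lam * normT T u)
    (h2 : normT T y' ≤ lamd * normT T u')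
    (h3 : normT T u * normT T u' ≤ U) :
    ∀ t ∈ Set.Icc (0:ℝ) T, |y t| ≤ Real.sqrt (2 * lam * lamd * U) := by
  intro t ht
  set μ : Measure ℝ := volume.restrict (Set.Ioc 0 T) with hμ
  have hycont : ContinuousOn y (Set.Icc 0 T) := fun s hs => (hyderiv s hs).continuousWithinAt
  have hyat : ∀ s ∈ Set.Ioo (0:ℝ) T, HasDerivAt y (y' s) s := fun s hs =>
    (hyderiv s (Set.Ioo_subset_Icc_self hs)).hasDerivAt (Icc_mem_nhds hs.1 hs.2)
  have hmeas' : AEStronglyMeasurable y' μ := by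
    rw [hμ, ← restrict_Ioo_eq_restrict_Ioc]
    refine AEStronglyMeasurable.congr (f := deriv y) (measurable_deriv y).aestronglyMeasurable ?_
    filter_upwards [ae_restrict_mem measurableSet_Ioo] with s hs
    exact (hyat s hs).deriv
  have hmeas : AEStronglyMeasurable y μ :=
    (hycont.mono Set.Ioc_subset_Icc_self).aestronglyMeasurable measurableSet_Ioc
  have hysq : Integrable (fun s => (y s) ^ 2) μ :=
    ((hycont.pow 2).integrableOn_Icc).mono_set Set.Ioc_subset_Icc_self
  have hy'sq : Integrable (fun s => (y' s) ^ 2) μ :=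
    (intervalIntegrable_iff_integrableOn_Ioc_of_le hT.le).1 hy'L2
  have hLy : MemLp y 2 μ := (memLp_two_iff_integrable_sq hmeas).2 hysq
  have hLy' : MemLp y' 2 μ := (memLp_two_iff_integrable_sq hmeas').2 hy'sq
  have hprod : Integrable (fun s => y s * y' s) μ := hLy.integrable_mul hLy'
  have hCS : ∫ s, ‖y s‖ * ‖y' s‖ ∂μ ≤ normT T y * normT T y' := by
    have := integral_mul_norm_le_Lp_mul_Lq (μ := μ) (f := y) (g := y')
      (p := 2) (q := 2) Real.HolderConjugate.two_two (by simpa using hLy) (by simpa using hLy')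
    simpa [normT, intervalIntegral.integral_of_le hT.le, Real.sqrt_eq_rpow] using this
  have key : ∀ a b, 0 ≤ a → a ≤ b → b ≤ T →
      |y b ^ 2 - y a ^ 2| ≤ 2 * ∫ s, ‖y s‖ * ‖y' s‖ ∂μ := by
    intro a b ha hab hb
    have hsub : Set.Ioc a b ⊆ Set.Ioc 0 T := Set.Ioc_subset_Ioc ha hb
    have hint : IntegrableOn (fun s => y s * y' s) (Set.Ioc a b) := 
      IntegrableOn.mono_set (t := Set.Ioc 0 T) hprod hsub
    have hFTC : ∫ s in a..b, 2 * (y s * y' s) = y b ^ 2 - y a ^ 2 := by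
      refine intervalIntegral.integral_eq_sub_of_hasDerivAt_of_le (f := fun s => y s ^ 2) hab
        ((hycont.mono (Set.Icc_subset_Icc ha hb)).pow 2) ?_ ?_
      · intro s hs
        have := (hyat s ⟨ha.trans_lt hs.1, hs.2.trans_le hb⟩).pow 2
        have he : ((2:ℕ):ℝ) * y s ^ (2 - 1) * y' s = 2 * (y s * y' s) := by
          norm_num [mul_assoc]
        rw [he] at this
        exact this
      · exact (intervalIntegrable_iff_integrableOn_Ioc_of_le hab).2 (hint.const_mul 2)
    rw [← hFTC, intervalIntegral.integral_const_mul, abs_mul, abs_two]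
    gcongr
    rw [intervalIntegral.integral_of_le hab, ← Real.norm_eq_abs]
    refine (norm_integral_le_integral_norm _).trans ?_
    simp only [norm_mul]
    refine setIntegral_mono_set (s := Set.Ioc a b) (t := Set.Ioc 0 T) ?_ ?_ ?_
    · have := hprod.norm
      simp only [norm_mul] at this
      exact this
    · exact Filter.Eventually.of_forall fun s => by positivity
    · exact hsub.eventuallyLE
  have hb : y t ^ 2 ≤ 2 * ∫ s, ‖y s‖ * ‖y' s‖ ∂μ := by
    rcases le_total t₀ t with h | h
    · have := key t₀ t ht₀.1 h ht.2
      rw [hy0] at this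
      simpa using this
    · have := key t t₀ ht.1 h ht₀.2
      rw [hy0] at this
      simpa using this
  apply Real.abs_le_sqrt
  have hm : normT T y * normT T y' ≤ (lam * normT T u) * (lamd * normT T u') :=
    mul_le_mul h1 h2 (Real.sqrt_nonneg _) (mul_nonneg hlam (Real.sqrt_nonneg _))
  have h4 := mul_le_mul_of_nonneg_left h3 (mul_nonneg hlam hlamd)
  nlinarith
end

section
/- Let A ≥ 0 and c ≤ d be real numbers, and let φ : ℝ → ℝ satisfy φ(0) = 0 and c·x² ≤ φ(x)·x ≤ d·x² for all x with |x| ≤ A. Let y : ℝ → ℝ be continuous with |y(t)| ≤ A for all t ≥ 0 and y² integrable on [0,∞). Then (∫₀^∞ (φ(y(t)) − ((c+d)/2)·y(t))² dt)^{1/2} ≤ ((d−c)/2) · (∫₀^∞ y(t)² dt)^{1/2}. -/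
open MeasureTheory Real

/-- Containment (22) (analytic content): the scaled graph of a static nonlinearity `φ`
sector-bounded in `[c, d]` on `[−A, A]`, restricted to signals of amplitude at most `A`,
is contained in the disk `D_{[c,d]}`, expressed as the norm inequality
`‖φ∘y − ((c+d)/2)y‖ ≤ ((d−c)/2)‖y‖`. -/
theorem stmt_5 (A c d : ℝ) (hA : 0 ≤ A) (hcd : c ≤ d)
    (φ : ℝ → ℝ) (hφ0 : φ 0 = 0)
    (hsector : ∀ x : ℝ, |x| ≤ A → c * x ^ 2 ≤ φ x * x ∧ φ x * x ≤ d * x ^ 2)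
    (y : ℝ → ℝ) (hy : Continuous y)
    (hyA : ∀ t : ℝ, 0 ≤ t → |y t| ≤ A)
    (hyL2 : IntegrableOn (fun t => (y t) ^ 2) (Set.Ioi (0:ℝ))) :
    Real.sqrt (∫ t in Set.Ioi (0:ℝ), (φ (y t) - ((c + d) / 2) * y t) ^ 2) ≤
      ((d - c) / 2) * Real.sqrt (∫ t in Set.Ioi (0:ℝ), (y t) ^ 2) := by
  have hpt : ∀ x : ℝ, |x| ≤ A →
      (φ x - ((c + d) / 2) * x) ^ 2 ≤ ((d - c) / 2) ^ 2 * x ^ 2 := by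
    intro x hx
    obtain ⟨h1, h2⟩ := hsector x hx
    by_cases h0 : x = 0
    · subst h0
      simp [hφ0]
    · have hx2 : 0 < x ^ 2 := by positivity
      have h3 := mul_nonneg (sub_nonneg.mpr h1) (sub_nonneg.mpr h2)
      have h4 : (φ x * x - c * x ^ 2) * (d * x ^ 2 - φ x * x) =
          x ^ 2 * (((d - c) / 2) ^ 2 * x ^ 2 - (φ x - ((c + d) / 2) * x) ^ 2) := by ring
      rw [h4] at h3
      exact sub_nonneg.mp (nonneg_of_mul_nonneg_right h3 hx2)
  have hr : 0 ≤ (d - c) / 2 := by linarith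
  have hint : (∫ t in Set.Ioi (0:ℝ), (φ (y t) - ((c + d) / 2) * y t) ^ 2) ≤
      ∫ t in Set.Ioi (0:ℝ), ((d - c) / 2) ^ 2 * (y t) ^ 2 := by
    apply integral_mono_of_nonneg
    · exact Filter.Eventually.of_forall fun t => sq_nonneg _
    · exact hyL2.const_mul _
    · filter_upwards [ae_restrict_mem measurableSet_Ioi] with t ht
      exact hpt _ (hyA t (le_of_lt ht))
  rw [integral_const_mul] at hint
  calc _ ≤ Real.sqrt (((d - c) / 2) ^ 2 * ∫ t in Set.Ioi (0:ℝ), (y t) ^ 2) :=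
        Real.sqrt_le_sqrt hint
    _ = _ := by rw [Real.sqrt_mul (sq_nonneg _), Real.sqrt_sq hr]
end

section
/- Let n ∈ ℕ, let f : ℝⁿ × ℝ → ℝⁿ satisfy f(−x, −v) = −f(x, v) for all x ∈ ℝⁿ and v ∈ ℝ, let T > 0, and let u : ℝ → ℝ satisfy u(t + T/2) = −u(t) for all t. Suppose x : ℝ → ℝⁿ is T-periodic and satisfies x'(t) = f(x(t), u(t)) for all t, and suppose that any two T-periodic solutions of x'(t) = f(x(t), u(t)) coincide. Then x(t + T/2) = −x(t) for all t ∈ ℝ. -/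
/-- Symmetry argument in the proof of Theorem 1: if the vector field satisfies
`f(−x, −v) = −f(x, v)`, the input has odd half-wave symmetry, and the `T`-periodic
solution of `x' = f(x, u(t))` is unique, then the solution inherits the odd half-wave
symmetry `x(t + T/2) = −x(t)`. -/
theorem stmt_16 (n : ℕ) (f : (Fin n → ℝ) × ℝ → (Fin n → ℝ))
    (hf : ∀ (x : Fin n → ℝ) (v : ℝ), f (-x, -v) = -f (x, v))
    (T : ℝ) (hT : 0 < T) (u : ℝ → ℝ) (hu : ∀ t : ℝ, u (t + T / 2) = -u t)
    (x : ℝ → Fin n → ℝ) (hxper : ∀ t : ℝ, x (t + T) = x t)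
    (hx : ∀ t : ℝ, HasDerivAt x (f (x t, u t)) t)
    (huniq : ∀ z : ℝ → Fin n → ℝ, (∀ t : ℝ, z (t + T) = z t) →
      (∀ t : ℝ, HasDerivAt z (f (z t, u t)) t) → z = x) :
    ∀ t : ℝ, x (t + T / 2) = -x t := by
  have h := huniq (fun t => -x (t + T / 2)) ?_ ?_
  · intro t
    have h1 := congrFun h t
    rw [← h1, neg_neg]
  · intro t
    have e : t + T + T / 2 = (t + T / 2) + T := by ring
    simp only [e, hxper]
  · intro t
    have h1 := ((hx (t + T / 2)).comp_add_const t (T / 2)).fun_neg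
    rw [hu, ← hf, neg_neg] at h1
    exact h1
end
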